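/- arXiv:1203.0831 — 3 statements merged into one kernel-verified Lean document; each statement's English description precedes it below -/
import Mathlib

section
/- Let C be a category, J a small filtered category, and F : J ⥤ C a functor such that for every morphism j → j′ in J the transition map F(j) → F(j′) is a monomorphism in C. Then for every object j of J, the colimit-cocone leg yoneda(F(j)) → colim(F ⋙ yoneda) is a monomorphism in the category Ind C of ind-objects of C. -/
open CategoryTheory Limits

universe v u

/-- if `F : J ⥤ C` is a filtered diagram all of whose transition maps are
monomorphisms (an admissible ind-object), then each colimit-cocone leg
`yoneda (F j) ⟶ colim (F ⋙ yoneda)` is a monomorphism in `Ind C`. -/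
theorem mono_colimit_ι_ind_of_mono {C : Type u} [Category.{v} C]
    {J : Type v} [SmallCategory J] [IsFiltered J] (F : J ⥤ C)
    (hF : ∀ {j j' : J} (f : j ⟶ j'), Mono (F.map f)) (j : J) :
    Mono (colimit.ι (F ⋙ Ind.yoneda) j) := by
  refine (Ind.inclusion C).mono_of_mono_map ?_
  have hc := isColimitOfPreserves (Ind.inclusion C) (colimit.isColimit (F ⋙ Ind.yoneda))
  have (i i' : J) (f : i ⟶ i') :
      Mono (((F ⋙ Ind.yoneda) ⋙ Ind.inclusion C).map f) :=
    have := hF f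
    ((MorphismProperty.monomorphisms _).arrow_mk_iso_iff
      ((Functor.mapArrowFunctor _ _).mapIso Ind.yonedaCompInclusion |>.app (.mk (F.map f)))).2
      (inferInstanceAs (Mono (yoneda.map (F.map f))))
  rw [NatTrans.mono_iff_mono_app]
  intro X
  have hX := isColimitOfPreserves ((evaluation _ _).obj X) hc
  rw [mono_iff_injective]
  intro x y hxy
  obtain ⟨k, f, h⟩ := (Types.FilteredColimit.isColimit_eq_iff' hX x y).1 hxy
  have := (NatTrans.mono_iff_mono_app _).1 (this _ _ f) X
  exact (mono_iff_injective _).1 this h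
end

section
/- Let C be a category, J a small filtered category, and F : J ⥤ C a functor such that for every morphism j → j′ in J the transition map F(j) → F(j′) is a monomorphism in C. Suppose there is an isomorphism g : colim(F ⋙ yoneda) ≅ yoneda(X) in Ind C for some object X of C. Then there exists an object j₀ of J such that the composite yoneda(F(j₀)) → colim(F ⋙ yoneda) → yoneda(X) of the cocone leg with g is an isomorphism in Ind C (equivalently, the corresponding morphism F(j₀) → X is an isomorphism in C), and for every morphism j₀ → j in J the transition map F(j₀) → F(j) is an isomorphism in C. In other words, an admissible ind-object that is isomorphic in Ind C to an object of C is essentially constant. -/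
open CategoryTheory Limits

universe v u

/-- Morphisms in `Ind C` out of an object `A` of `C` are the sections over `A` of the
underlying presheaf. -/
noncomputable def coyonedaObjIndYonedaIso {C : Type u} [Category.{v} C] (A : C) :
    coyoneda.obj (Opposite.op (Ind.yoneda.obj A)) ≅
      Ind.inclusion C ⋙ (evaluation Cᵒᵖ (Type v)).obj (Opposite.op A) :=
  NatIso.ofComponents
    (fun B => ((Ind.inclusion.fullyFaithful.homEquiv).trans
      (((Ind.yonedaCompInclusion.app A).homFromEquiv).trans yonedaEquiv)).toIso)
    (fun {B B'} f => by
      ext x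
      simp [yonedaEquiv, Functor.FullyFaithful.homEquiv])

/-- Objects of `C` are compact in `Ind C`. -/
lemma preservesColimitsOfShape_coyoneda_obj_indYoneda {C : Type u} [Category.{v} C] (A : C)
    (J : Type v) [SmallCategory J] [IsFiltered J] :
    PreservesColimitsOfShape J (coyoneda.obj (Opposite.op (Ind.yoneda.obj A))) :=
  preservesColimitsOfShape_of_natIso (coyonedaObjIndYonedaIso A).symm

section

variable {C : Type u} [Category.{v} C] {J : Type v} [SmallCategory J] [IsFiltered J] (F : J ⥤ C)

lemma exists_indYoneda_map_comp_colimit_ι_eq {A : C}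
    (f : Ind.yoneda.obj A ⟶ colimit (F ⋙ Ind.yoneda)) :
    ∃ (j : J) (h : A ⟶ F.obj j), Ind.yoneda.map h ≫ colimit.ι (F ⋙ Ind.yoneda) j = f := by
  have := preservesColimitsOfShape_coyoneda_obj_indYoneda A J
  obtain ⟨j, y, hy⟩ := Types.jointly_surjective_of_isColimit
    (isColimitOfPreserves (coyoneda.obj (Opposite.op (Ind.yoneda.obj A)))
      (colimit.isColimit (F ⋙ Ind.yoneda))) f
  obtain ⟨h, rfl⟩ := Ind.yoneda.map_surjective y
  exact ⟨j, h, hy⟩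

lemma exists_comp_map_eq_of_indYoneda_map_comp_colimit_ι_eq {A : C} {j : J}
    {a b : A ⟶ F.obj j}
    (hab : Ind.yoneda.map a ≫ colimit.ι (F ⋙ Ind.yoneda) j =
      Ind.yoneda.map b ≫ colimit.ι (F ⋙ Ind.yoneda) j) :
    ∃ (k : J) (f : j ⟶ k), a ≫ F.map f = b ≫ F.map f := by
  have := preservesColimitsOfShape_coyoneda_obj_indYoneda A J
  obtain ⟨k, f, h⟩ := (Types.FilteredColimit.isColimit_eq_iff'
    (isColimitOfPreserves (coyoneda.obj (Opposite.op (Ind.yoneda.obj A)))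
      (colimit.isColimit (F ⋙ Ind.yoneda))) (Ind.yoneda.map a) (Ind.yoneda.map b)).1 hab
  exact ⟨k, f, Ind.yoneda.map_injective (by simpa using h)⟩

/-- If all transition maps are monomorphisms, an object of `C` which is isomorphic to the colimit
is isomorphic to every term of the diagram through which the inverse isomorphism factors. -/
lemma isIso_of_indYoneda_map_comp_colimit_ι_eq
    (hF : ∀ {j j' : J} (f : j ⟶ j'), Mono (F.map f)) {X : C}
    (g : colimit (F ⋙ Ind.yoneda) ≅ Ind.yoneda.obj X) {j : J} (h : X ⟶ F.obj j)
    (hh : Ind.yoneda.map h ≫ colimit.ι (F ⋙ Ind.yoneda) j = g.inv) : IsIso h := by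
  obtain ⟨q, hq⟩ := Ind.yoneda.map_surjective (colimit.ι (F ⋙ Ind.yoneda) j ≫ g.hom)
  refine ⟨q, Ind.yoneda.map_injective ?_, ?_⟩
  · rw [Functor.map_comp, hq, reassoc_of% hh, g.inv_hom_id, CategoryTheory.Functor.map_id]
  · obtain ⟨k, f, hf⟩ := exists_comp_map_eq_of_indYoneda_map_comp_colimit_ι_eq F
      (a := q ≫ h) (b := 𝟙 _) (j := j) (by
        rw [Functor.map_comp, Category.assoc, hh, hq]
        simp)
    have := hF f
    exact (cancel_mono (F.map f)).1 hf

end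

/-- an admissible ind-object (a filtered diagram `F : J ⥤ C` all of whose
transition maps are monomorphisms) which is isomorphic in `Ind C` to an object of `C` is
essentially constant: there is `j₀` such that the composite of the cocone leg at `j₀` with
the isomorphism is an isomorphism, and all transition maps out of `j₀` are isomorphisms. -/
theorem essentially_constant_of_iso_yoneda {C : Type u} [Category.{v} C]
    {J : Type v} [SmallCategory J] [IsFiltered J] (F : J ⥤ C)
    (hF : ∀ {j j' : J} (f : j ⟶ j'), Mono (F.map f)) (X : C)
    (g : colimit (F ⋙ Ind.yoneda) ≅ Ind.yoneda.obj X) :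
    ∃ j₀ : J, IsIso (colimit.ι (F ⋙ Ind.yoneda) j₀ ≫ g.hom) ∧
      ∀ {j : J} (f : j₀ ⟶ j), IsIso (F.map f) := by
  obtain ⟨j₀, h, hh⟩ := exists_indYoneda_map_comp_colimit_ι_eq F g.inv
  have : IsIso h := isIso_of_indYoneda_map_comp_colimit_ι_eq F hF g h hh
  refine ⟨j₀, ?_, fun {j} f => ?_⟩
  · have hid : Ind.yoneda.map h ≫ colimit.ι (F ⋙ Ind.yoneda) j₀ ≫ g.hom = 𝟙 _ := by
      rw [reassoc_of% hh, g.inv_hom_id]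
    exact IsIso.of_isIso_fac_left hid
  · have hw := colimit.w (F ⋙ Ind.yoneda) f
    have : IsIso (h ≫ F.map f) := isIso_of_indYoneda_map_comp_colimit_ι_eq F hF g _ (by
      rw [Functor.map_comp, Category.assoc, ← hh, ← hw, Functor.comp_map])
    exact IsIso.of_isIso_comp_left h (F.map f)
end

section
/- Let A be an additive category (preadditive with finite biproducts) and let F : ℕ ⥤ A be a functor from the poset category ℕ (with objects 1, 2, 3, …) whose transition maps ρ : F(k) → F(k+1) are all monomorphisms. Define a functor T F : ℕ ⥤ A by (T F)(n) = F(n−1) ⊕ F(n−2) ⊕ ⋯ ⊕ F(1) (so (T F)(1) = 0), with transition map (T F)(n) → (T F)(n+1) sending the summand F(k) into the summand F(k+1) via ρ for each 1 ≤ k ≤ n−1 and mapping nothing onto the new bottom summand F(1) (i.e. the map (ρ ⊕ ⋯ ⊕ ρ, 0)). Let F ⊕ T F : ℕ ⥤ A denote the pointwise biproduct, with transitions the biproduct of those of F and T F. Then the ind-objects determined by F ⊕ T F and by T F are isomorphic in Ind A, i.e. colim((F ⊕ T F) ⋙ yoneda) ≅ colim(T F ⋙ yoneda), naturally identified via the equalities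 (F ⊕ T F)(n) = (T F)(n+1). (This is the flasque structure underlying the Eilenberg swindle on admissible ℕ-indexed ind-objects.) -/
open CategoryTheory Limits

attribute [local instance] CategoryTheory.Limits.hasBinaryBiproducts_of_finite_biproducts

universe u

/-- The Eilenberg-swindle functor on ℕ-indexed diagrams:
`(T F)(n) = F(n-1) ⊕ F(n-2) ⊕ ⋯ ⊕ F(0)` (so `(T F)(0) = 0`), with transition map
`(T F)(n) ⟶ (T F)(m)` (for `n ≤ m`) sending the summand `F(k)` into the summand
`F(k + (m-n))` via the transition maps of `F`, and hitting none of the new bottom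
summands.  (Here the summand of `(T F)(n)` indexed by `i : Fin n` is `F(n-1-i)`, and it
is sent to the summand of `(T F)(m)` indexed by the same `i`, i.e. to `F(m-1-i)`.) -/
noncomputable def swindle {A : Type u} [Category.{0} A] [Preadditive A]
    [HasFiniteBiproducts A] (F : ℕ ⥤ A) : ℕ ⥤ A where
  obj n := ⨁ (fun i : Fin n => F.obj (n - 1 - (i : ℕ)))
  map {n m} h := biproduct.desc (fun i =>
    F.map (homOfLE (by have := leOfHom h; omega : n - 1 - (i : ℕ) ≤ m - 1 - (i : ℕ))) ≫
      biproduct.ι (fun j : Fin m => F.obj (m - 1 - (j : ℕ))) (Fin.castLE (leOfHom h) i))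
  map_id n := by ext i; simp
  map_comp {n m k} h h' := by
    ext i
    simp only [biproduct.ι_desc, Category.assoc, biproduct.ι_desc_assoc, ← F.map_comp_assoc,
      homOfLE_comp, Fin.castLE_castLE]
    rfl

/-- The pointwise biproduct `F ⊕ G` of two ℕ-indexed diagrams, with transition maps the
biproducts of those of `F` and of `G`. -/
noncomputable def pointwiseBiprod {A : Type u} [Category.{0} A] [Preadditive A]
    [HasFiniteBiproducts A] (F G : ℕ ⥤ A) : ℕ ⥤ A where
  obj n := F.obj n ⊞ G.obj n
  map h := biprod.map (F.map h) (G.map h)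
  map_id n := by ext <;> simp
  map_comp h h' := by ext <;> simp

/-- The successor functor on `ℕ`. -/
abbrev natSuccFunctor : ℕ ⥤ ℕ :=
  Monotone.functor (f := fun n : ℕ => n + 1) fun _ _ h => Nat.succ_le_succ h

instance natSuccFunctor_final : natSuccFunctor.Final :=
  (Monotone.final_functor_iff _).2 fun n => ⟨n, n.le_succ⟩

/-- Splitting off the first summand of a biproduct indexed by `Fin (n + 1)`. -/
noncomputable def biprodBiproductIso {A : Type u} [Category.{0} A] [Preadditive A]
    [HasFiniteBiproducts A] {n : ℕ} {Z : A} {Y : Fin n → A} {X : Fin (n + 1) → A}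
    (e₀ : Z ≅ X 0) (e : ∀ i, Y i ≅ X i.succ) : Z ⊞ ⨁ Y ≅ ⨁ X where
  hom := biprod.desc (e₀.hom ≫ biproduct.ι X 0)
    (biproduct.desc fun i => (e i).hom ≫ biproduct.ι X i.succ)
  inv := biproduct.desc (Fin.cases (e₀.inv ≫ biprod.inl) fun i =>
    (e i).inv ≫ biproduct.ι Y i ≫ biprod.inr)
  hom_inv_id := by
    apply biprod.hom_ext'
    · simp
    · apply biproduct.hom_ext'
      simp
  inv_hom_id := by
    apply biproduct.hom_ext'
    intro i
    cases i using Fin.cases <;> simp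

theorem biprodBiproductIso_hom_naturality {A : Type u} [Category.{0} A] [Preadditive A]
    [HasFiniteBiproducts A] {n m : ℕ} (h : n ≤ m) {Z Z' : A} {Y : Fin n → A} {Y' : Fin m → A}
    {X : Fin (n + 1) → A} {X' : Fin (m + 1) → A}
    (e₀ : Z ≅ X 0) (e : ∀ i, Y i ≅ X i.succ) (e₀' : Z' ≅ X' 0) (e' : ∀ i, Y' i ≅ X' i.succ)
    (p : Z ⟶ Z') (q : ∀ i, Y i ⟶ Y' (Fin.castLE h i))
    (r : ∀ i, X i ⟶ X' (Fin.castLE (Nat.succ_le_succ h) i))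
    (h₀ : p ≫ e₀'.hom = e₀.hom ≫ r 0)
    (h₁ : ∀ i, q i ≫ (e' _).hom = (e i).hom ≫ r i.succ) :
    biprod.map p (biproduct.desc fun i => q i ≫ biproduct.ι Y' _) ≫
        (biprodBiproductIso e₀' e').hom =
      (biprodBiproductIso e₀ e).hom ≫ biproduct.desc fun i => r i ≫ biproduct.ι X' _ := by
  apply biprod.hom_ext'
  · simp only [biprodBiproductIso, biprod.inl_map_assoc, biprod.inl_desc, biprod.inl_desc_assoc,
      Category.assoc, biproduct.ι_desc]
    rw [← Category.assoc, ← Category.assoc]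
    exact h₀ =≫ biproduct.ι X' 0
  · apply biproduct.hom_ext'
    intro i
    simp only [biprodBiproductIso, biprod.inr_map_assoc, biprod.inr_desc, biprod.inr_desc_assoc,
      Category.assoc, biproduct.ι_desc, biproduct.ι_desc_assoc]
    rw [← Category.assoc, ← Category.assoc]
    exact h₁ i =≫ biproduct.ι X' (Fin.castLE h i).succ

/-- The identification `F(n) ⊕ (T F)(n) ≅ (T F)(n+1)`. -/
noncomputable def swindleSuccIso {A : Type u} [Category.{0} A] [Preadditive A]
    [HasFiniteBiproducts A] (F : ℕ ⥤ A) (n : ℕ) :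
    F.obj n ⊞ (swindle F).obj n ≅ (swindle F).obj (n + 1) :=
  biprodBiproductIso (X := fun i : Fin (n + 1) => F.obj (n + 1 - 1 - (i : ℕ))) (Iso.refl _)
    fun i => F.mapIso (eqToIso (by simp only [Fin.val_succ]; omega))

/-- The identifications `(F ⊕ T F)(n) ≅ (T F)(n+1)` are natural in `n`. -/
noncomputable def pointwiseBiprodSwindleIso {A : Type u} [Category.{0} A] [Preadditive A]
    [HasFiniteBiproducts A] (F : ℕ ⥤ A) :
    pointwiseBiprod F (swindle F) ≅ natSuccFunctor ⋙ swindle F :=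
  NatIso.ofComponents (swindleSuccIso F) fun {n m} f => by
    apply biprodBiproductIso_hom_naturality (leOfHom f)
    · exact (Category.comp_id _).trans (Category.id_comp _).symm
    · intro i
      rw [Functor.mapIso_hom, Functor.mapIso_hom]
      refine (F.map_comp _ _).symm.trans (Eq.trans ?_ (F.map_comp (eqToIso _).hom (homOfLE _)))
      rfl

/-- for an ℕ-indexed diagram `F` in an additive category `A` all of whose
transition maps are monomorphisms, the ind-objects determined by the pointwise biproduct
`F ⊕ T F` and by the swindle `T F` are isomorphic in `Ind A`,
i.e. `colim ((F ⊕ T F) ⋙ yoneda) ≅ colim (T F ⋙ yoneda)` (via the identifications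
`(F ⊕ T F)(n) = (T F)(n+1)`). -/
theorem swindle_flasque {A : Type u} [Category.{0} A] [Preadditive A] [HasFiniteBiproducts A]
    (F : ℕ ⥤ A) (hF : ∀ {n m : ℕ} (f : n ⟶ m), Mono (F.map f)) :
    Nonempty (colimit (pointwiseBiprod F (swindle F) ⋙ Ind.yoneda) ≅
      colimit (swindle F ⋙ Ind.yoneda)) := by
  exact ⟨HasColimit.isoOfNatIso
    (Functor.isoWhiskerRight (pointwiseBiprodSwindleIso F) Ind.yoneda ≪≫
      Functor.associator _ _ _) ≪≫
    Functor.Final.colimitIso natSuccFunctor (swindle F ⋙ Ind.yoneda)⟩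
end
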